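/- arXiv:1712.00314 — 3 statements merged into one kernel-verified Lean document; each statement's English description precedes it below -/
import Mathlib

section
/- The special precovered category spc(𝒢(𝒞)) is closed under extensions: if 0→L→M→N→0 is a short exact sequence in 𝒜 and both L and N admit special 𝒢(𝒞)-precovers, then M admits a special 𝒢(𝒞)-precover. -/
open CategoryTheory CategoryTheory.Limits CategoryTheory.Abelian ZeroObject

universe w t v u

variable {A : Type u} [Category.{v} A] [Abelian A]

/-- `f`, `g` form a short exact sequence `0 ⟶ X ⟶ Y ⟶ Z ⟶ 0` in `A`. -/
def IsSES {X Y Z : A} (f : X ⟶ Y) (g : Y ⟶ Z) : Prop :=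
  ∃ hw : f ≫ g = 0, (ShortComplex.mk f g hw).ShortExact

/-- The short exact sequence `0 ⟶ X ⟶ Y ⟶ Z ⟶ 0` remains exact after applying
`Hom_A(C, -)` for every `C` in `𝒞`. -/
def HomLeftExact (𝒞 : A → Prop) {X Y Z : A} (f : X ⟶ Y) (g : Y ⟶ Z) : Prop :=
  ∀ ⦃C : A⦄, 𝒞 C →
    Function.Injective (fun h : C ⟶ X => h ≫ f) ∧
    Function.Exact (fun h : C ⟶ X => h ≫ f) (fun h : C ⟶ Y => h ≫ g) ∧
    Function.Surjective (fun h : C ⟶ Y => h ≫ g)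

/-- The short exact sequence `0 ⟶ X ⟶ Y ⟶ Z ⟶ 0` remains exact after applying
`Hom_A(-, C)` for every `C` in `𝒞`. -/
def HomRightExact (𝒞 : A → Prop) {X Y Z : A} (f : X ⟶ Y) (g : Y ⟶ Z) : Prop :=
  ∀ ⦃C : A⦄, 𝒞 C →
    Function.Injective (fun h : Z ⟶ C => g ≫ h) ∧
    Function.Exact (fun h : Z ⟶ C => g ≫ h) (fun h : Y ⟶ C => f ≫ h) ∧
    Function.Surjective (fun h : Y ⟶ C => f ≫ h)

/-- `M` belongs to the Gorenstein subcategory `𝒢(𝒞)`: there is an exact sequence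
`⋯ ⟶ C_1 ⟶ C_0 ⟶ C^0 ⟶ C^1 ⟶ ⋯` with all terms in `𝒞`, which remains exact after
applying `Hom_A(C,-)` and `Hom_A(-,C)` for every `C ∈ 𝒞`, such that
`M ≅ Im(C_0 ⟶ C^0)`. -/
def IsGorenstein (𝒞 : A → Prop) (M : A) : Prop :=
  ∃ (X : ℤ → A) (d : ∀ n : ℤ, X n ⟶ X (n + 1)) (hw : ∀ n, d n ≫ d (n + 1) = 0),
    (∀ n, 𝒞 (X n)) ∧
    (∀ n, (ShortComplex.mk (d n) (d (n + 1)) (hw n)).Exact) ∧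
    (∀ (n : ℤ) ⦃C : A⦄, 𝒞 C →
      Function.Exact (fun h : C ⟶ X n => h ≫ d n) (fun h : C ⟶ X (n + 1) => h ≫ d (n + 1))) ∧
    (∀ (n : ℤ) ⦃C : A⦄, 𝒞 C →
      Function.Exact (fun h : X (n + 1 + 1) ⟶ C => d (n + 1) ≫ h)
        (fun h : X (n + 1) ⟶ C => d n ≫ h)) ∧
    Nonempty (M ≅ Limits.image (d 0))

/-- `𝒞` is a full additive subcategory closed under isomorphisms, encoded as a predicate
closed under isomorphisms, containing a zero object and closed under binary biproducts. -/
def IsAdditiveClosed (𝒞 : A → Prop) : Prop :=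
  (∀ ⦃X Y : A⦄, (X ≅ Y) → 𝒞 X → 𝒞 Y) ∧ 𝒞 (0 : A) ∧ ∀ ⦃X Y : A⦄, 𝒞 X → 𝒞 Y → 𝒞 (X ⊞ Y)

/-- `𝒫(A)` is a generator for `𝒞`: for every `C ∈ 𝒞` there is a short exact sequence
`0 ⟶ C' ⟶ P ⟶ C ⟶ 0` with `P` projective and `C' ∈ 𝒞`. -/
def ProjIsGeneratorFor (𝒞 : A → Prop) : Prop :=
  ∀ ⦃C : A⦄, 𝒞 C → ∃ (C' P : A) (f : C' ⟶ P) (g : P ⟶ C),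
    Projective P ∧ 𝒞 C' ∧ IsSES f g

section Ext

variable [HasExt.{w} A]

/-- `𝒞` is self-orthogonal: `Ext^i(C, C') = 0` for all `i ≥ 1` and `C, C' ∈ 𝒞`. -/
def SelfOrthogonal (𝒞 : A → Prop) : Prop :=
  ∀ ⦃C C' : A⦄, 𝒞 C → 𝒞 C' → ∀ i : ℕ, 1 ≤ i → Subsingleton (Abelian.Ext C C' i)

/-- `M ∈ 𝒢(𝒞)^{⊥1}`, i.e. `Ext^1(G, M) = 0` for every `G ∈ 𝒢(𝒞)`. -/
def RightPerp1 (𝒞 : A → Prop) (M : A) : Prop :=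
  ∀ ⦃G : A⦄, IsGorenstein 𝒞 G → Subsingleton (Abelian.Ext G M 1)

/-- `f : G ⟶ M` is a special `𝒢(𝒞)`-precover of `M`. -/
def IsSpecialPrecover (𝒞 : A → Prop) {G M : A} (f : G ⟶ M) : Prop :=
  IsGorenstein 𝒞 G ∧ Epi f ∧ RightPerp1 𝒞 (kernel f) ∧
    ∀ ⦃G' : A⦄, IsGorenstein 𝒞 G' → Function.Surjective (fun h : G' ⟶ G => h ≫ f)

/-- `M` belongs to the special precovered category `spc(𝒢(𝒞))`. -/
def HasSpecialPrecover (𝒞 : A → Prop) (M : A) : Prop :=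
  ∃ (G : A) (f : G ⟶ M), IsSpecialPrecover 𝒞 f

/-- `𝒞` is a generator for `𝒢(𝒞)^{⊥1}`. -/
def GeneratorForPerp (𝒞 : A → Prop) : Prop :=
  ∀ ⦃T : A⦄, RightPerp1 𝒞 T → ∃ (T' C : A) (f : T' ⟶ C) (g : C ⟶ T),
    𝒞 C ∧ RightPerp1 𝒞 T' ∧ IsSES f g

end Ext

section ShortExactSequences

variable {X Y Z : A} {f : X ⟶ Y} {g : Y ⟶ Z}

lemma IsSES.mono (h : IsSES f g) : Mono f := h.2.mono_f

lemma IsSES.epi (h : IsSES f g) : Epi g := h.2.epi_g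

lemma IsSES.exists_lift (h : IsSES f g) {T : A} (k : T ⟶ Y) (hk : k ≫ g = 0) :
    ∃ l : T ⟶ X, l ≫ f = k := by
  obtain ⟨hw, h⟩ := h
  have := h.mono_f
  exact ⟨h.exact.lift k hk, h.exact.lift_f k hk⟩

lemma IsSES.exists_desc (h : IsSES f g) {T : A} (k : Y ⟶ T) (hk : f ≫ k = 0) :
    ∃ l : Z ⟶ T, g ≫ l = k := by
  obtain ⟨hw, h⟩ := h
  have := h.epi_g
  exact ⟨h.exact.desc k hk, h.exact.g_desc k hk⟩

lemma isSES_kernel (g : Y ⟶ Z) [Epi g] : IsSES (kernel.ι g) g :=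
  ⟨kernel.condition g, { exact := ShortComplex.exact_kernel g }⟩

lemma isSES_cokernel (f : X ⟶ Y) [Mono f] : IsSES f (cokernel.π f) :=
  ⟨cokernel.condition f, { exact := ShortComplex.exact_cokernel f }⟩

lemma isSES_id_zero (X : A) : IsSES (𝟙 X) (0 : X ⟶ (0 : A)) :=
  ⟨by simp, (ShortComplex.Splitting.ofIsIsoOfIsZero _ (by dsimp; infer_instance)
    (isZero_zero A)).shortExact⟩

lemma isSES_zero_id (X : A) : IsSES (0 : (0 : A) ⟶ X) (𝟙 X) :=
  ⟨by simp, (ShortComplex.Splitting.ofIsZeroOfIsIso _ (isZero_zero A)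
    (by dsimp; infer_instance)).shortExact⟩

lemma isSES_biprod (X Z : A) : IsSES (biprod.inl : X ⟶ X ⊞ Z) biprod.snd :=
  ⟨by simp, (ShortComplex.Splitting.ofHasBinaryBiproduct X Z).shortExact⟩

lemma IsSES.of_iso (h : IsSES f g) {X' Y' Z' : A} (e₁ : X ≅ X') (e₂ : Y ≅ Y') (e₃ : Z ≅ Z') :
    IsSES (e₁.inv ≫ f ≫ e₂.hom) (e₂.inv ≫ g ≫ e₃.hom) := by
  obtain ⟨hw, h⟩ := h
  refine ⟨by simp [reassoc_of% hw], ShortComplex.shortExact_of_iso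
    (ShortComplex.isoMk e₁ e₂ e₃ ?_ ?_) h⟩ <;> simp

lemma IsSES.nonempty_iso_cokernel (h : IsSES f g) : Nonempty (Z ≅ cokernel f) := by
  obtain ⟨hw, h⟩ := h
  exact ⟨IsColimit.coconePointUniqueUpToIso h.gIsCokernel (colimit.isColimit _)⟩

lemma IsSES.nonempty_iso_kernel (h : IsSES f g) : Nonempty (X ≅ kernel g) := by
  obtain ⟨hw, h⟩ := h
  exact ⟨IsLimit.conePointUniqueUpToIso h.fIsKernel (limit.isLimit _)⟩

/-- The snake input of a morphism of short exact sequences. -/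
noncomputable def snakeInputOfShortExact {S₁ S₂ : ShortComplex A} (φ : S₁ ⟶ S₂)
    (h₁ : S₁.ShortExact) (h₂ : S₂.ShortExact) : ShortComplex.SnakeInput A where
  L₀ := kernel φ
  L₁ := S₁
  L₂ := S₂
  L₃ := cokernel φ
  v₀₁ := kernel.ι φ
  v₁₂ := φ
  v₂₃ := cokernel.π φ
  w₀₂ := kernel.condition φ
  w₁₃ := cokernel.condition φ
  h₀ := kernelIsKernel φ
  h₃ := cokernelIsCokernel φ
  L₁_exact := h₁.exact
  epi_L₁_g := h₁.epi_g
  L₂_exact := h₂.exact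
  mono_L₂_f := h₂.mono_f

variable {X' Y' Z' : A} {f' : X' ⟶ Y'} {g' : Y' ⟶ Z'}

lemma IsSES.exists_kernel (h : IsSES f g) (h' : IsSES f' g')
    (a : X ⟶ X') (b : Y ⟶ Y') (c : Z ⟶ Z') (hab : f ≫ b = a ≫ f') (hbc : g ≫ c = b ≫ g')
    [Epi a] : ∃ (i : kernel a ⟶ kernel b) (p : kernel b ⟶ kernel c), IsSES i p := by
  obtain ⟨hw, h⟩ := h
  obtain ⟨hw', h'⟩ := h'
  let φ : ShortComplex.mk f g hw ⟶ ShortComplex.mk f' g' hw' :=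
    { τ₁ := a, τ₂ := b, τ₃ := c, comm₁₂ := hab.symm, comm₂₃ := hbc.symm }
  let S := snakeInputOfShortExact φ h h'
  have : Mono S.L₁.f := h.mono_f
  have h₃ : IsZero S.L₃.X₁ :=
    (isZero_cokernel_of_epi a).of_iso
      (IsColimit.coconePointUniqueUpToIso S.h₃τ₁ (colimit.isColimit _))
  have hS : IsSES S.L₀.f S.L₀.g := ⟨S.L₀.zero,
    { exact := S.L₀_exact
      epi_g := S.L₁'_exact.epi_f (h₃.eq_of_tgt _ _) }⟩
  exact ⟨_, _, hS.of_iso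
    (IsLimit.conePointUniqueUpToIso S.h₀τ₁ (limit.isLimit _))
    (IsLimit.conePointUniqueUpToIso S.h₀τ₂ (limit.isLimit _))
    (IsLimit.conePointUniqueUpToIso S.h₀τ₃ (limit.isLimit _))⟩

lemma IsSES.exists_cokernel (h : IsSES f g) (h' : IsSES f' g')
    (a : X ⟶ X') (b : Y ⟶ Y') (c : Z ⟶ Z') (hab : f ≫ b = a ≫ f') (hbc : g ≫ c = b ≫ g')
    [Mono c] : ∃ (i : cokernel a ⟶ cokernel b) (p : cokernel b ⟶ cokernel c), IsSES i p := by
  obtain ⟨hw, h⟩ := h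
  obtain ⟨hw', h'⟩ := h'
  let φ : ShortComplex.mk f g hw ⟶ ShortComplex.mk f' g' hw' :=
    { τ₁ := a, τ₂ := b, τ₃ := c, comm₁₂ := hab.symm, comm₂₃ := hbc.symm }
  let S := snakeInputOfShortExact φ h h'
  have : Epi S.L₂.g := h'.epi_g
  have h₀ : IsZero S.L₀.X₃ :=
    (isZero_kernel_of_mono c).of_iso
      (IsLimit.conePointUniqueUpToIso S.h₀τ₃ (limit.isLimit _))
  have hS : IsSES S.L₃.f S.L₃.g := ⟨S.L₃.zero,
    { exact := S.L₃_exact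
      mono_f := S.L₂'_exact.mono_g (h₀.eq_of_src _ _) }⟩
  exact ⟨_, _, hS.of_iso
    (IsColimit.coconePointUniqueUpToIso S.h₃τ₁ (colimit.isColimit _))
    (IsColimit.coconePointUniqueUpToIso S.h₃τ₂ (colimit.isColimit _))
    (IsColimit.coconePointUniqueUpToIso S.h₃τ₃ (colimit.isColimit _))⟩

lemma IsSES.mono_middle (h : IsSES f g) (h' : IsSES f' g')
    {a : X ⟶ X'} {b : Y ⟶ Y'} {c : Z ⟶ Z'} (hab : f ≫ b = a ≫ f') (hbc : g ≫ c = b ≫ g')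
    [Mono a] [Mono c] : Mono b := by
  have := h'.mono
  refine Preadditive.mono_of_cancel_zero _ fun {T} k hk => ?_
  have hkg : k ≫ g = 0 := by
    rw [← cancel_mono c, Category.assoc, hbc, reassoc_of% hk, zero_comp, zero_comp]
  obtain ⟨l, rfl⟩ := h.exists_lift k hkg
  have : l = 0 := by
    rw [← cancel_mono a, ← cancel_mono f', Category.assoc, ← hab, ← Category.assoc, hk]
    simp
  simp [this]

lemma IsSES.epi_middle (h : IsSES f g) (h' : IsSES f' g')
    {a : X ⟶ X'} {b : Y ⟶ Y'} {c : Z ⟶ Z'} (hab : f ≫ b = a ≫ f') (hbc : g ≫ c = b ≫ g')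
    [Epi a] [Epi c] : Epi b := by
  have := h.epi
  refine Preadditive.epi_of_cancel_zero _ fun {T} k hk => ?_
  have hkf : f' ≫ k = 0 := by
    rw [← cancel_epi a, ← reassoc_of% hab, hk, comp_zero, comp_zero]
  obtain ⟨l, rfl⟩ := h'.exists_desc k hkf
  have : l = 0 := by
    rw [← cancel_epi c, ← cancel_epi g, reassoc_of% hbc, hk]
    simp
  simp [this]

/-- A pushout of a short exact sequence is a short exact sequence. -/
lemma IsSES.pushout (h : IsSES f g) {T : A} (w : X ⟶ T) :
    IsSES (pushout.inr f w) (pushout.desc g 0 (by simp [h.1]) : pushout f w ⟶ Z) := by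
  have := h.mono
  have := h.epi
  refine ⟨pushout.inr_desc _ _ _, ?_⟩
  have hepi : Epi (pushout.desc g 0 (by simp [h.1]) : Limits.pushout f w ⟶ Z) :=
    epi_of_epi_fac (pushout.inl_desc g 0 (by simp [h.1]))
  refine { exact := ?_, mono_f := by dsimp; infer_instance, epi_g := hepi }
  refine ShortComplex.exact_of_g_is_cokernel _ (CokernelCofork.IsColimit.ofπ' _ _ ?_)
  intro V k hk
  dsimp at k hk
  have hk' : f ≫ pushout.inl f w ≫ k = 0 := by
    rw [pushout.condition_assoc, hk, comp_zero]
  exact ⟨(h.exists_desc _ hk').choose, by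
    apply pushout.hom_ext
    · rw [pushout.inl_desc_assoc]
      exact (h.exists_desc _ hk').choose_spec
    · rw [pushout.inr_desc_assoc, zero_comp, hk]⟩

end ShortExactSequences

section ExtOne

variable [HasExt.{w} A] {X Y Z : A} {f : X ⟶ Y} {g : Y ⟶ Z}

lemma IsSES.exists_lift_of_ext (h : IsSES f g) {G : A} [Subsingleton (Ext G X 1)] (k : G ⟶ Z) :
    ∃ l : G ⟶ Y, l ≫ g = k := by
  obtain ⟨hw, h⟩ := h
  obtain ⟨y, hy⟩ := Ext.covariant_sequence_exact₃ G h (Ext.mk₀ k) (zero_add 1)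
    (Subsingleton.elim (α := Ext G X 1) _ _)
  obtain ⟨l, rfl⟩ := Ext.addEquiv₀.symm.surjective y
  exact ⟨l, Ext.addEquiv₀.symm.injective (by simpa using hy)⟩

lemma IsSES.exists_extension_of_ext (h : IsSES f g) {G : A} [Subsingleton (Ext Z G 1)]
    (k : X ⟶ G) : ∃ l : Y ⟶ G, f ≫ l = k := by
  obtain ⟨hw, h⟩ := h
  obtain ⟨y, hy⟩ := Ext.contravariant_sequence_exact₁ h G (Ext.mk₀ k) (add_zero 1)
    (Subsingleton.elim (α := Ext Z G 1) _ _)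
  obtain ⟨l, rfl⟩ := Ext.addEquiv₀.symm.surjective y
  exact ⟨l, Ext.addEquiv₀.symm.injective (by simpa using hy)⟩

lemma IsSES.subsingleton_ext_left (h : IsSES f g) {G : A} [Subsingleton (Ext G Y 1)]
    (H : ∀ k : G ⟶ Z, ∃ l : G ⟶ Y, l ≫ g = k) : Subsingleton (Ext G X 1) := by
  obtain ⟨hw, h⟩ := h
  refine subsingleton_of_forall_eq 0 fun x => ?_
  obtain ⟨z, rfl⟩ := Ext.covariant_sequence_exact₁ G h x
    (Subsingleton.elim (α := Ext G Y 1) _ _) (zero_add 1)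
  obtain ⟨k, rfl⟩ := Ext.addEquiv₀.symm.surjective z
  obtain ⟨l, rfl⟩ := H k
  have := h.comp_extClass
  simp only [Ext.addEquiv₀_symm_apply]
  rw [← Ext.mk₀_comp_mk₀, Ext.comp_assoc_of_second_deg_zero]
  erw [this]
  simp

lemma IsSES.subsingleton_ext_right (h : IsSES f g) {G : A} [Subsingleton (Ext Y G 1)]
    (H : ∀ k : X ⟶ G, ∃ l : Y ⟶ G, f ≫ l = k) : Subsingleton (Ext Z G 1) := by
  obtain ⟨hw, h⟩ := h
  refine subsingleton_of_forall_eq 0 fun x => ?_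
  obtain ⟨z, rfl⟩ := Ext.contravariant_sequence_exact₃ h G x
    (Subsingleton.elim (α := Ext Y G 1) _ _) (add_zero 1)
  obtain ⟨k, rfl⟩ := Ext.addEquiv₀.symm.surjective z
  obtain ⟨l, rfl⟩ := H k
  simp only [Ext.addEquiv₀_symm_apply]
  rw [← Ext.mk₀_comp_mk₀]
  exact h.extClass_comp_assoc _

lemma IsSES.subsingleton_ext_middle (h : IsSES f g) {G : A} [Subsingleton (Ext G X 1)]
    [Subsingleton (Ext G Z 1)] : Subsingleton (Ext G Y 1) := by
  obtain ⟨hw, h⟩ := h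
  refine subsingleton_of_forall_eq 0 fun x => ?_
  obtain ⟨z, rfl⟩ := Ext.covariant_sequence_exact₂ G h x
    (Subsingleton.elim (α := Ext G Z 1) _ _)
  rw [Subsingleton.elim (α := Ext G X 1) z 0]
  simp

lemma IsSES.subsingleton_ext_middle' (h : IsSES f g) {G : A} [Subsingleton (Ext X G 1)]
    [Subsingleton (Ext Z G 1)] : Subsingleton (Ext Y G 1) := by
  obtain ⟨hw, h⟩ := h
  refine subsingleton_of_forall_eq 0 fun x => ?_
  obtain ⟨z, rfl⟩ := Ext.contravariant_sequence_exact₂ h G x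
    (Subsingleton.elim (α := Ext X G 1) _ _)
  rw [Subsingleton.elim (α := Ext Z G 1) z 0]
  simp

end ExtOne

lemma exists_int_sequence {α : Type*} (R : α → α → Prop) (hr : ∀ a, ∃ b, R a b)
    (hl : ∀ b, ∃ a, R a b) (a : α) :
    ∃ Z : ℤ → α, Z 1 = a ∧ ∀ n, R (Z n) (Z (n + 1)) := by
  choose s hs using hr
  choose t ht using hl
  let Z : ℤ → α := fun n => match n with
    | Int.ofNat n => s^[n] a
    | Int.negSucc n => t^[n + 1] a
  have hZ : ∀ n, R (Z n) (Z (n + 1)) := by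
    rintro (n | n)
    · change R (s^[n] a) (s^[n + 1] a)
      rw [Function.iterate_succ_apply']
      exact hs _
    · cases n with
      | zero => exact ht a
      | succ n =>
        change R (t^[n + 1 + 1] a) (t^[n + 1] a)
        rw [Function.iterate_succ_apply' t (n + 1)]
        exact ht _
  refine ⟨fun n => Z (n - 1), rfl, fun n => ?_⟩
  have := hZ (n - 1)
  rwa [show n - 1 + 1 = n + 1 - 1 by ring] at this

lemma IsSES.exact_comp {X₀ X₁ X₂ Z₁ Z₂ : A} {p₀ : X₀ ⟶ Z₁} {i₁ : Z₁ ⟶ X₁} {p₁ : X₁ ⟶ Z₂}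
    (h : IsSES i₁ p₁) (i₂ : Z₂ ⟶ X₂) [Epi p₀] [Mono i₂]
    (hw : (p₀ ≫ i₁) ≫ p₁ ≫ i₂ = 0) : (ShortComplex.mk (p₀ ≫ i₁) (p₁ ≫ i₂) hw).Exact := by
  obtain ⟨hw', h⟩ := h
  have hw'' : (p₀ ≫ i₁) ≫ p₁ = 0 := by simp [hw']
  let φ : ShortComplex.mk (p₀ ≫ i₁) p₁ hw'' ⟶ ShortComplex.mk i₁ p₁ hw' :=
    { τ₁ := p₀, τ₂ := 𝟙 _, τ₃ := 𝟙 _ }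
  let ψ : ShortComplex.mk (p₀ ≫ i₁) p₁ hw'' ⟶ ShortComplex.mk (p₀ ≫ i₁) (p₁ ≫ i₂) hw :=
    { τ₁ := 𝟙 _, τ₂ := 𝟙 _, τ₃ := i₂ }
  have : Epi φ.τ₁ := by assumption
  have : Mono φ.τ₃ := by dsimp [φ]; infer_instance
  have : IsIso φ.τ₂ := by dsimp [φ]; infer_instance
  have : Epi ψ.τ₁ := by dsimp [ψ]; infer_instance
  have : Mono ψ.τ₃ := by assumption
  have : IsIso ψ.τ₂ := by dsimp [ψ]; infer_instance
  exact (ShortComplex.exact_iff_of_epi_of_isIso_of_mono ψ).1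
    ((ShortComplex.exact_iff_of_epi_of_isIso_of_mono φ).2 h.exact)

/-- The images of consecutive maps in an exact sequence form a short exact sequence. -/
lemma isSES_image {X Y Z : A} {f : X ⟶ Y} {g : Y ⟶ Z} (hw : f ≫ g = 0)
    (h : (ShortComplex.mk f g hw).Exact) : IsSES (Limits.image.ι f) (factorThruImage g) := by
  have hw' : Limits.image.ι f ≫ factorThruImage g = 0 := by
    rw [← cancel_epi (factorThruImage f), ← cancel_mono (Limits.image.ι g)]
    simpa using hw
  have hw'' : f ≫ factorThruImage g = 0 := by
    rw [← cancel_mono (Limits.image.ι g)]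
    simpa using hw
  let φ : ShortComplex.mk f (factorThruImage g) hw'' ⟶
      ShortComplex.mk (Limits.image.ι f) (factorThruImage g) hw' :=
    { τ₁ := factorThruImage f, τ₂ := 𝟙 _, τ₃ := 𝟙 _ }
  let ψ : ShortComplex.mk f (factorThruImage g) hw'' ⟶ ShortComplex.mk f g hw :=
    { τ₁ := 𝟙 _, τ₂ := 𝟙 _, τ₃ := Limits.image.ι g }
  have : Epi φ.τ₁ := by dsimp [φ]; infer_instance
  have : Mono φ.τ₃ := by dsimp [φ]; infer_instance
  have : IsIso φ.τ₂ := by dsimp [φ]; infer_instance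
  have : Epi ψ.τ₁ := by dsimp [ψ]; infer_instance
  have : Mono ψ.τ₃ := by dsimp [ψ]; infer_instance
  have : IsIso ψ.τ₂ := by dsimp [ψ]; infer_instance
  have hex : (ShortComplex.mk (Limits.image.ι f) (factorThruImage g) hw').Exact :=
    (ShortComplex.exact_iff_of_epi_of_isIso_of_mono φ).1
      ((ShortComplex.exact_iff_of_epi_of_isIso_of_mono ψ).2 h)
  exact ⟨hw', { exact := hex }⟩

lemma IsGorenstein.of_iso {𝒞 : A → Prop} {M M' : A} (e : M ≅ M') (h : IsGorenstein 𝒞 M) :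
    IsGorenstein 𝒞 M' := by
  obtain ⟨X, d, hw, h₁, h₂, h₃, h₄, ⟨e'⟩⟩ := h
  exact ⟨X, d, hw, h₁, h₂, h₃, h₄, ⟨e.symm ≪≫ e'⟩⟩

section Gorenstein

variable [HasExt.{w} A] {𝒞 : A → Prop}

/-- The conditions on a class `Q` of objects which force its members to be Gorenstein. -/
structure IsSyzygyClass (𝒞 Q : A → Prop) : Prop where
  exists_right : ∀ ⦃M : A⦄, Q M → ∃ (X Z : A) (i : M ⟶ X) (p : X ⟶ Z), 𝒞 X ∧ Q Z ∧ IsSES i p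
  exists_left : ∀ ⦃M : A⦄, Q M → ∃ (Z X : A) (i : Z ⟶ X) (p : X ⟶ M), 𝒞 X ∧ Q Z ∧ IsSES i p
  ext_to : ∀ ⦃M C : A⦄, Q M → 𝒞 C → Subsingleton (Abelian.Ext M C 1)
  ext_from : ∀ ⦃M C : A⦄, Q M → 𝒞 C → Subsingleton (Abelian.Ext C M 1)

lemma IsSyzygyClass.isGorenstein {Q : A → Prop} (hQ : IsSyzygyClass 𝒞 Q) {M : A} (hM : Q M) :
    IsGorenstein 𝒞 M := by
  obtain ⟨Z, hZ₁, hZ⟩ := exists_int_sequence (α := {M : A // Q M})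
    (fun a b => ∃ (X : A) (i : a.1 ⟶ X) (p : X ⟶ b.1), 𝒞 X ∧ IsSES i p)
    (fun a => by
      obtain ⟨X, Z, i, p, hX, hZ, h⟩ := hQ.exists_right a.2
      exact ⟨⟨Z, hZ⟩, X, i, p, hX, h⟩)
    (fun b => by
      obtain ⟨Z, X, i, p, hX, hZ, h⟩ := hQ.exists_left b.2
      exact ⟨⟨Z, hZ⟩, X, i, p, hX, h⟩) ⟨M, hM⟩
  choose X i p hX hS using hZ
  have hi : ∀ n, Mono (i n) := fun n => (hS n).mono
  have hp : ∀ n, Epi (p n) := fun n => (hS n).epi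
  have hw : ∀ n, (p n ≫ i (n + 1)) ≫ p (n + 1) ≫ i (n + 1 + 1) = 0 := fun n => by
    obtain ⟨h, -⟩ := hS (n + 1)
    simp [reassoc_of% h]
  refine ⟨X, fun n => p n ≫ i (n + 1), hw, hX, fun n => (hS (n + 1)).exact_comp _ (hw n), ?_, ?_,
    ⟨?_⟩⟩
  · intro n C hC y
    have := hQ.ext_from (Z n).2 hC
    constructor
    · intro hy
      obtain ⟨k, rfl⟩ := (hS (n + 1)).exists_lift y (by
        rw [← cancel_mono (i (n + 1 + 1))]
        simpa using hy)
      obtain ⟨l, rfl⟩ := (hS n).exists_lift_of_ext k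
      exact ⟨l, by simp⟩
    · rintro ⟨l, rfl⟩
      have := hw n
      simp only [Category.assoc] at this ⊢
      rw [this, comp_zero]
  · intro n C hC y
    have := hQ.ext_to (Z (n + 1 + 1 + 1)).2 hC
    constructor
    · intro hy
      obtain ⟨k, rfl⟩ := (hS (n + 1)).exists_desc y (by
        rw [← cancel_epi (p n)]
        simpa using hy)
      obtain ⟨l, rfl⟩ := (hS (n + 1 + 1)).exists_extension_of_ext k
      exact ⟨l, by simp⟩
    · rintro ⟨l, rfl⟩
      have := hw n
      dsimp only
      rw [← Category.assoc, this, zero_comp]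
  · have e : M = (Z (0 + 1)).1 := congrArg Subtype.val hZ₁.symm
    have := strongEpi_of_epi (p 0)
    exact eqToIso e ≪≫ image.isoStrongEpiMono (p 0) (i (0 + 1)) rfl

lemma subsingleton_ext_one (hso : SelfOrthogonal 𝒞) {C C' : A} (hC : 𝒞 C) (hC' : 𝒞 C') :
    Subsingleton (Abelian.Ext C C' 1) :=
  hso hC hC' 1 le_rfl

lemma IsGorenstein.of_mem (hadd : IsAdditiveClosed 𝒞) (hso : SelfOrthogonal 𝒞) {C : A}
    (hC : 𝒞 C) : IsGorenstein 𝒞 C :=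
  IsSyzygyClass.isGorenstein (Q := 𝒞)
    { exists_right := fun M hM => ⟨M, 0, _, _, hM, hadd.2.1, isSES_id_zero M⟩
      exists_left := fun M hM => ⟨0, M, _, _, hM, hadd.2.1, isSES_zero_id M⟩
      ext_to := fun _ _ => subsingleton_ext_one hso
      ext_from := fun _ _ h h' => subsingleton_ext_one hso h' h } hC

/-- The class of Gorenstein objects is itself a syzygy class. -/
lemma isSyzygyClass_isGorenstein (hso : SelfOrthogonal 𝒞) :
    IsSyzygyClass 𝒞 (IsGorenstein 𝒞) := by
  have key : ∀ ⦃M : A⦄, IsGorenstein 𝒞 M → ∃ Q : A → Prop, IsSyzygyClass 𝒞 Q ∧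
      ∃ M', Q M' ∧ Nonempty (M' ≅ M) := by
    rintro M ⟨X, d, hw, hX, hex, hl, hr, ⟨e⟩⟩
    have hses : ∀ n, IsSES (Limits.image.ι (d n)) (factorThruImage (d (n + 1))) :=
      fun n => isSES_image (hw n) (hex n)
    refine ⟨fun M' => ∃ n, M' = image (d n), ⟨?_, ?_, ?_, ?_⟩, image (d 0), ⟨0, rfl⟩, ⟨e.symm⟩⟩
    · rintro _ ⟨n, rfl⟩
      exact ⟨_, _, _, _, hX _, ⟨_, rfl⟩, hses n⟩
    · rintro _ ⟨n, rfl⟩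
      obtain ⟨m, rfl⟩ : ∃ m, n = m + 1 := ⟨n - 1, by ring⟩
      exact ⟨_, _, _, _, hX _, ⟨_, rfl⟩, hses m⟩
    · rintro _ C ⟨n, rfl⟩ hC
      obtain ⟨m, rfl⟩ : ∃ m, n = m + 1 + 1 := ⟨n - 2, by ring⟩
      have := subsingleton_ext_one hso (hX (m + 1 + 1)) hC
      refine (hses (m + 1)).subsingleton_ext_right fun k => ?_
      obtain ⟨l, hl⟩ := (hr m hC (factorThruImage (d (m + 1)) ≫ k)).1 (by
        have := (hses m).1
        dsimp only
        rw [← Limits.image.fac (d m), Category.assoc, reassoc_of% this, zero_comp,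
          comp_zero])
      refine ⟨l, ?_⟩
      rw [← cancel_epi (factorThruImage (d (m + 1))), Limits.image.fac_assoc]
      exact hl
    · rintro _ C ⟨n, rfl⟩ hC
      have := subsingleton_ext_one hso hC (hX (n + 1))
      refine (hses n).subsingleton_ext_left fun k => ?_
      obtain ⟨l, hl⟩ := (hl (n + 1) hC (k ≫ Limits.image.ι (d (n + 1)))).1 (by
        have := (hses (n + 1)).1
        dsimp only
        rw [← Limits.image.fac (d (n + 1 + 1)), Category.assoc, reassoc_of% this, zero_comp,
          comp_zero])
      refine ⟨l, ?_⟩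
      rw [← cancel_mono (Limits.image.ι (d (n + 1))), Category.assoc, Limits.image.fac]
      exact hl
  have ses_of_iso {X Y : A} (e : X ≅ Y) : IsSES e.hom (0 : Y ⟶ (0 : A)) := by
    simpa using (isSES_id_zero X).of_iso (Iso.refl X) e (Iso.refl _)
  refine ⟨fun M hM => ?_, fun M hM => ?_, fun M C hM hC => ?_, fun M C hM hC => ?_⟩ <;>
    obtain ⟨Q, hQ, M', hM', ⟨e⟩⟩ := key hM
  · obtain ⟨X, Z, i, p, hX, hZ, h⟩ := hQ.exists_right hM'
    exact ⟨_, _, _, _, hX, hQ.isGorenstein hZ, h.of_iso e (Iso.refl _) (Iso.refl _)⟩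
  · obtain ⟨Z, X, i, p, hX, hZ, h⟩ := hQ.exists_left hM'
    exact ⟨_, _, _, _, hX, hQ.isGorenstein hZ, h.of_iso (Iso.refl _) (Iso.refl _) e⟩
  · have := hQ.ext_to hM' hC
    have : Subsingleton (Abelian.Ext (0 : A) C 1) :=
      subsingleton_of_forall_eq 0 fun x => by
        rw [← Ext.mk₀_id_comp x, (isZero_zero A).eq_of_src (𝟙 (0 : A)) 0]
        simp
    exact (ses_of_iso e).subsingleton_ext_middle'
  · have := hQ.ext_from hM' hC
    have : Subsingleton (Abelian.Ext C (0 : A) 1) :=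
      subsingleton_of_forall_eq 0 fun x => by
        rw [← Ext.comp_mk₀_id x, (isZero_zero A).eq_of_src (𝟙 (0 : A)) 0]
        simp
    exact (ses_of_iso e).subsingleton_ext_middle

lemma IsGorenstein.extension (hadd : IsAdditiveClosed 𝒞) (hso : SelfOrthogonal 𝒞)
    {L M N : A} {f : L ⟶ M} {g : M ⟶ N} (h : IsSES f g) (hL : IsGorenstein 𝒞 L)
    (hN : IsGorenstein 𝒞 N) : IsGorenstein 𝒞 M := by
  have hG := isSyzygyClass_isGorenstein hso
  refine IsSyzygyClass.isGorenstein (Q := fun M => ∃ (L N : A) (f : L ⟶ M) (g : M ⟶ N),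
    IsSES f g ∧ IsGorenstein 𝒞 L ∧ IsGorenstein 𝒞 N) ?_ ⟨L, N, f, g, h, hL, hN⟩
  clear! L M N
  refine ⟨?_, ?_, ?_, ?_⟩
  · rintro M ⟨L, N, f, g, h, hL, hN⟩
    obtain ⟨X, Z, i, p, hX, hZ, hi⟩ := hG.exists_right hL
    obtain ⟨X', Z', i', p', hX', hZ', hi'⟩ := hG.exists_right hN
    have := hG.ext_to hN hX
    obtain ⟨u, hu⟩ := h.exists_extension_of_ext i
    have := hi.mono
    have := hi'.mono
    have hab : f ≫ biprod.lift u (g ≫ i') = i ≫ biprod.inl := by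
      ext <;> simp [hu, reassoc_of% h.1]
    have hbc : g ≫ i' = biprod.lift u (g ≫ i') ≫ biprod.snd := by simp
    have := h.mono_middle (isSES_biprod X X') hab hbc
    obtain ⟨a, b, hab⟩ := h.exists_cokernel (isSES_biprod X X') _ _ _ hab hbc
    obtain ⟨e⟩ := hi.nonempty_iso_cokernel
    obtain ⟨e'⟩ := hi'.nonempty_iso_cokernel
    exact ⟨_, _, _, _, hadd.2.2 hX hX', ⟨_, _, _, _, hab, hZ.of_iso e, hZ'.of_iso e'⟩,
      isSES_cokernel _⟩
  · rintro M ⟨L, N, f, g, h, hL, hN⟩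
    obtain ⟨Z, X, i, p, hX, hZ, hp⟩ := hG.exists_left hL
    obtain ⟨Z', X', i', p', hX', hZ', hp'⟩ := hG.exists_left hN
    have := hG.ext_from hL hX'
    obtain ⟨u, hu⟩ := h.exists_lift_of_ext p'
    have := hp.epi
    have := hp'.epi
    have hab : biprod.inl ≫ biprod.desc (p ≫ f) u = p ≫ f := by simp
    have hbc : biprod.snd ≫ p' = biprod.desc (p ≫ f) u ≫ g := by
      ext <;> simp [hu, h.1]
    have := (isSES_biprod X X').epi_middle h hab hbc
    obtain ⟨a, b, hab⟩ := (isSES_biprod X X').exists_kernel h _ _ _ hab hbc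
    obtain ⟨e⟩ := hp.nonempty_iso_kernel
    obtain ⟨e'⟩ := hp'.nonempty_iso_kernel
    exact ⟨_, _, _, _, hadd.2.2 hX hX', ⟨_, _, _, _, hab, hZ.of_iso e, hZ'.of_iso e'⟩,
      isSES_kernel _⟩
  · rintro M C ⟨L, N, f, g, h, hL, hN⟩ hC
    have := hG.ext_to hL hC
    have := hG.ext_to hN hC
    exact h.subsingleton_ext_middle'
  · rintro M C ⟨L, N, f, g, h, hL, hN⟩ hC
    have := hG.ext_from hL hC
    have := hG.ext_from hN hC
    exact h.subsingleton_ext_middle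

/-- A Gorenstein object is a quotient of a projective object by a Gorenstein object. -/
lemma IsGorenstein.exists_projective (hadd : IsAdditiveClosed 𝒞) (hso : SelfOrthogonal 𝒞)
    (hgen : ProjIsGeneratorFor 𝒞) {G : A} (hG : IsGorenstein 𝒞 G) :
    ∃ (Ω P : A) (i : Ω ⟶ P) (p : P ⟶ G), Projective P ∧ IsGorenstein 𝒞 Ω ∧ IsSES i p := by
  obtain ⟨Z, X, i, p, hX, hZ, hp⟩ := (isSyzygyClass_isGorenstein hso).exists_left hG
  obtain ⟨C', P, j, q, hP, hC', hq⟩ := hgen hX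
  have := hp.epi
  have := hq.epi
  have : Epi (0 : C' ⟶ (0 : A)) := ⟨fun _ _ _ => (isZero_zero A).eq_of_src _ _⟩
  obtain ⟨a, b, hab⟩ := hq.exists_kernel (isSES_zero_id G) (0 : C' ⟶ (0 : A)) (q ≫ p) p
    (by simp [reassoc_of% hq.1]) (by simp)
  obtain ⟨e⟩ := hp.nonempty_iso_kernel
  exact ⟨_, P, _, q ≫ p, hP, IsGorenstein.extension hadd hso hab
    ((IsGorenstein.of_mem hadd hso hC').of_iso kernelZeroIsoSource.symm) (hZ.of_iso e),
    isSES_kernel _⟩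

end Gorenstein

/-- `spc(𝒢(𝒞))` is closed under extensions. -/
theorem stmt_11 [HasExt.{w} A] (𝒞 : A → Prop) (hadd : IsAdditiveClosed 𝒞)
    (hso : SelfOrthogonal 𝒞) (hgen : ProjIsGeneratorFor 𝒞)
    {L M N : A} (f : L ⟶ M) (g : M ⟶ N) (hses : IsSES f g)
    (hL : HasSpecialPrecover 𝒞 L) (hN : HasSpecialPrecover 𝒞 N) :
    HasSpecialPrecover 𝒞 M := by
  obtain ⟨G₁, p₁, hG₁, _, hK₁, hp₁⟩ := hL
  obtain ⟨G₂, p₂, hG₂, _, hK₂, -⟩ := hN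
  obtain ⟨Ω, P, i, q, _, hΩ, hi⟩ := hG₂.exists_projective hadd hso hgen
  have := hses.epi
  let v : P ⟶ M := Projective.factorThru (q ≫ p₂) g
  have hv : v ≫ g = q ≫ p₂ := Projective.factorThru_comp _ _
  obtain ⟨w, hw⟩ := hses.exists_lift (i ≫ v) (by simp [hv, reassoc_of% hi.1])
  obtain ⟨w', rfl⟩ := hp₁ hΩ w
  have hG := hi.pushout w'
  let π : pushout i w' ⟶ M := pushout.desc v (p₁ ≫ f) (by simpa using hw.symm)
  have hab : pushout.inr i w' ≫ π = p₁ ≫ f := pushout.inr_desc _ _ _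
  have hbc : pushout.desc q 0 (by simp [hi.1]) ≫ p₂ = π ≫ g := by
    apply pushout.hom_ext
    · rw [pushout.inl_desc_assoc, pushout.inl_desc_assoc, hv]
    · rw [pushout.inr_desc_assoc, pushout.inr_desc_assoc, Category.assoc, hses.1, zero_comp,
        comp_zero]
  have hπ : Epi π := hG.epi_middle hses hab hbc
  obtain ⟨a, b, hK⟩ := hG.exists_kernel hses p₁ π p₂ hab hbc
  have hperp : RightPerp1 𝒞 (kernel π) := fun G hG => by
    have := hK₁ hG
    have := hK₂ hG
    exact hK.subsingleton_ext_middle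
  refine ⟨_, π, IsGorenstein.extension hadd hso hG hG₁ hG₂, hπ, hperp, fun G' hG' k => ?_⟩
  have := hperp hG'
  exact (isSES_kernel π).exists_lift_of_ext k
end

section
/- Let 0→K→G→M→0 be a short exact sequence in 𝒜 with K∈𝒢(𝒞)^{⊥1} and G∈𝒢(𝒞). Then there exist an object C∈𝒞, an object K'∈𝒢(𝒞)^{⊥1}, and a short exact sequence 0→G→M⊕C→K'→0 in 𝒜. -/
open CategoryTheory CategoryTheory.Limits CategoryTheory.Abelian ZeroObject

universe w t v u

variable {A : Type u} [Category.{v} A] [Abelian A]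

/-- A Gorenstein object `H` is the cokernel of some `H' ⟶ C` with `H'` Gorenstein and `C ∈ 𝒞`,
along which every morphism from `H'` to an object of `𝒞` extends. -/
theorem IsGorenstein.exists_left_ses {𝒞 : A → Prop} {H : A} (hH : IsGorenstein 𝒞 H) :
    ∃ (H' C₀ : A) (i : H' ⟶ C₀) (p : C₀ ⟶ H), IsGorenstein 𝒞 H' ∧ 𝒞 C₀ ∧ IsSES i p ∧
      ∀ ⦃C : A⦄, 𝒞 C → Function.Surjective (fun h : C₀ ⟶ C => i ≫ h) := by
  obtain ⟨X, d, hw, hX, hex, hl, hr, ⟨e⟩⟩ := hH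
  let D : ∀ i j : ℤ, i + 1 = j → (X i ⟶ X j) := fun i j h => d i ≫ eqToHom (congrArg X h)
  have hD : ∀ i, D i (i + 1) rfl = d i := fun i => by simp [D]
  have hw' : ∀ (i j k : ℤ) (h : i + 1 = j) (h' : j + 1 = k), D i j h ≫ D j k h' = 0 := by
    rintro i _ _ rfl rfl
    rw [hD, hD, hw]
  have hex' : ∀ (i j k : ℤ) (h : i + 1 = j) (h' : j + 1 = k),
      (ShortComplex.mk (D i j h) (D j k h') (hw' i j k h h')).Exact := by
    rintro i _ _ rfl rfl
    simpa only [hD] using hex i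
  have hl' : ∀ (i j k : ℤ) (h : i + 1 = j) (h' : j + 1 = k) ⦃C : A⦄, 𝒞 C →
      Function.Exact (fun φ : C ⟶ X i => φ ≫ D i j h) (fun φ : C ⟶ X j => φ ≫ D j k h') := by
    rintro i _ _ rfl rfl C hC
    simpa only [hD] using hl i hC
  have hr' : ∀ (i j k : ℤ) (h : i + 1 = j) (h' : j + 1 = k) ⦃C : A⦄, 𝒞 C →
      Function.Exact (fun φ : X k ⟶ C => D j k h' ≫ φ) (fun φ : X j ⟶ C => D i j h ≫ φ) := by
    rintro i _ _ rfl rfl C hC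
    simpa only [hD] using hr i hC
  replace e : H ≅ image (D 0 (0 + 1) rfl) := e ≪≫ image.eqToIso (hD 0).symm
  have hι : Limits.image.ι (D (-1) 0 rfl) ≫ D 0 (0 + 1) rfl = 0 := by
    rw [← cancel_epi (factorThruImage (D (-1) 0 rfl)), image.fac_assoc,
      hw' (-1) 0 (0 + 1) rfl rfl, comp_zero]
  have hιp : Limits.image.ι (D (-1) 0 rfl) ≫ factorThruImage (D 0 (0 + 1) rfl) ≫ e.inv = 0 := by
    rw [← cancel_mono (e.hom ≫ Limits.image.ι (D 0 (0 + 1) rfl))]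
    simpa using hι
  have hs : ∀ n : ℤ, n - 1 + 1 = n + 1 - 1 := fun n => by lia
  have hH' : IsGorenstein 𝒞 (image (D (-1) 0 rfl)) :=
    ⟨fun n => X (n - 1), fun n => D (n - 1) (n + 1 - 1) (hs n),
      fun n => hw' _ _ _ (hs n) (hs (n + 1)), fun n => hX _,
      fun n => hex' _ _ _ (hs n) (hs (n + 1)), fun n => hl' _ _ _ (hs n) (hs (n + 1)),
      fun n => hr' _ _ _ (hs n) (hs (n + 1)), ⟨Iso.refl _⟩⟩
  refine ⟨_, X 0, Limits.image.ι (D (-1) 0 rfl), factorThruImage (D 0 (0 + 1) rfl) ≫ e.inv,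
    hH', hX 0, ⟨hιp, ShortComplex.ShortExact.mk' ?_ ?_ ?_⟩, ?_⟩
  · rw [ShortComplex.exact_iff_exact_up_to_refinements]
    intro T (x : T ⟶ X 0) (hx : x ≫ factorThruImage (D 0 (0 + 1) rfl) ≫ e.inv = 0)
    obtain ⟨T', π, hπ, y, hy⟩ := (hex' (-1) 0 (0 + 1) rfl rfl).exact_up_to_refinements x (by
      have := hx =≫ (e.hom ≫ Limits.image.ι (D 0 (0 + 1) rfl))
      simpa using this)
    exact ⟨T', π, hπ, y ≫ factorThruImage _, by simpa using hy⟩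
  · dsimp only
    infer_instance
  · dsimp only
    infer_instance
  · intro C hC φ
    obtain ⟨ψ, hψ⟩ := (hr' (-2) (-1) 0 rfl rfl hC (factorThruImage (D (-1) 0 rfl) ≫ φ)).1 (by
      have h0 : D (-2) (-1) rfl ≫ factorThruImage (D (-1) 0 rfl) = 0 := by
        rw [← cancel_mono (Limits.image.ι (D (-1) 0 rfl)), Category.assoc, Limits.image.fac,
          hw' (-2) (-1) 0 rfl rfl, zero_comp]
      change D (-2) (-1) rfl ≫ factorThruImage (D (-1) 0 rfl) ≫ φ = 0
      rw [← Category.assoc, h0, zero_comp])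
    refine ⟨ψ, ?_⟩
    rw [← cancel_epi (factorThruImage (D (-1) 0 rfl))]
    simpa using hψ

/-- A Gorenstein object embeds into an object of `𝒞`. -/
theorem IsGorenstein.exists_mono {𝒞 : A → Prop} {H : A} (hH : IsGorenstein 𝒞 H) :
    ∃ (C : A) (i : H ⟶ C), 𝒞 C ∧ Mono i := by
  obtain ⟨X, d, -, hX, -, -, -, ⟨e⟩⟩ := hH
  exact ⟨X (0 + 1), e.hom ≫ Limits.image.ι _, hX _, inferInstance⟩

/-- Every object of `𝒞` is Gorenstein. -/
theorem isGorenstein_of_mem {𝒞 : A → Prop} {C : A} (hC : 𝒞 C) : IsGorenstein 𝒞 C := by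
  let d : ℤ → (C ⟶ C) := fun n => if Even n then 𝟙 C else 0
  have hd : ∀ n, (d n = 𝟙 C ∧ d (n + 1) = 0) ∨ (d n = 0 ∧ d (n + 1) = 𝟙 C) := fun n => by
    by_cases h : Even n <;> simp [d, h]
  have hw : ∀ n, d n ≫ d (n + 1) = 0 := fun n => by
    rcases hd n with ⟨h, h'⟩ | ⟨h, h'⟩ <;> simp [h, h']
  have hd0 : d 0 = 𝟙 C := by simp [d]
  refine ⟨fun _ => C, d, hw, fun _ => hC, fun n => ?_, fun n B _ => ?_, fun n B _ => ?_,
    ⟨(imageMonoIsoSource (𝟙 C)).symm ≪≫ image.eqToIso hd0.symm⟩⟩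
  · rw [ShortComplex.exact_iff_exact_up_to_refinements]
    intro T (x : T ⟶ C) (hx : x ≫ d (n + 1) = 0)
    refine ⟨T, 𝟙 T, inferInstance, x, ?_⟩
    rcases hd n with ⟨h, h'⟩ | ⟨h, h'⟩
    · simp [h]
    · rw [h', Category.comp_id] at hx
      simp [hx]
  · intro x
    rcases hd n with ⟨h, h'⟩ | ⟨h, h'⟩ <;> simp [h, h']
  · intro x
    rcases hd n with ⟨h, h'⟩ | ⟨h, h'⟩ <;> simp [h, h']

section Ext

variable [HasExt.{w} A]

/-- Dimension shifting along a short exact sequence in the first variable. -/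
theorem IsSES.subsingleton_ext_two {X Y Z T : A} {f : X ⟶ Y} {g : Y ⟶ Z} (h : IsSES f g)
    (hX : Subsingleton (Abelian.Ext X T 1)) (hY : Subsingleton (Abelian.Ext Y T 2)) :
    Subsingleton (Abelian.Ext Z T 2) := by
  obtain ⟨hw, hS⟩ := h
  refine subsingleton_of_forall_eq 0 fun x => ?_
  obtain ⟨y, rfl⟩ := Ext.contravariant_sequence_exact₃ hS T x (Subsingleton.elim _ _)
    (n₀ := 1) rfl
  rw [Subsingleton.elim y 0, Ext.comp_zero]

/-- If morphisms `X ⟶ T` extend along `f` then `Ext¹(Z, T)` embeds into `Ext¹(Y, T)`. -/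
theorem IsSES.subsingleton_ext_one {X Y Z T : A} {f : X ⟶ Y} {g : Y ⟶ Z} (h : IsSES f g)
    (hf : Function.Surjective (fun φ : Y ⟶ T => f ≫ φ))
    (hY : Subsingleton (Abelian.Ext Y T 1)) :
    Subsingleton (Abelian.Ext Z T 1) := by
  obtain ⟨hw, hS⟩ := h
  refine subsingleton_of_forall_eq 0 fun x => ?_
  obtain ⟨y, rfl⟩ := Ext.contravariant_sequence_exact₃ hS T x (Subsingleton.elim _ _)
    (n₀ := 0) rfl
  obtain ⟨φ, rfl⟩ := (Ext.mk₀_bijective X T).2 y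
  obtain ⟨ψ, rfl⟩ := hf φ
  dsimp only
  rw [← Ext.mk₀_comp_mk₀, hS.extClass_comp_assoc]

theorem SelfOrthogonal.rightPerp1 {𝒞 : A → Prop} (hso : SelfOrthogonal 𝒞) {C : A} (hC : 𝒞 C) :
    RightPerp1 𝒞 C := by
  intro H hH
  obtain ⟨H', C₀, i, p, -, hC₀, hses, hi⟩ := hH.exists_left_ses
  exact hses.subsingleton_ext_one (hi hC) (hso hC₀ hC 1 le_rfl)

theorem RightPerp1.subsingleton_ext_two {𝒞 : A → Prop} (hgen : ProjIsGeneratorFor 𝒞) {K : A}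
    (hK : RightPerp1 𝒞 K) {H : A} (hH : IsGorenstein 𝒞 H) :
    Subsingleton (Abelian.Ext H K 2) := by
  obtain ⟨H', C₀, i, p, hH', hC₀, hses, -⟩ := hH.exists_left_ses
  obtain ⟨C', P, i', p', hP, hC', hses'⟩ := hgen hC₀
  exact hses.subsingleton_ext_two (hK hH') (hses'.subsingleton_ext_two
    (hK (isGorenstein_of_mem hC')) (Ext.subsingleton_of_projective P K 1))

/-- The cokernel of `K ⟶ C` lies in `𝒢(𝒞)^{⊥1}` when `K` does and `C ∈ 𝒞`. -/
theorem IsSES.rightPerp1 {𝒞 : A → Prop} (hso : SelfOrthogonal 𝒞) (hgen : ProjIsGeneratorFor 𝒞)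
    {K C D : A} {f : K ⟶ C} {g : C ⟶ D} (h : IsSES f g) (hK : RightPerp1 𝒞 K) (hC : 𝒞 C) :
    RightPerp1 𝒞 D := by
  intro H hH
  have := hK.subsingleton_ext_two hgen hH
  have := hso.rightPerp1 hC hH
  obtain ⟨hw, hS⟩ := h
  refine subsingleton_of_forall_eq 0 fun x => ?_
  obtain ⟨y, rfl⟩ := Ext.covariant_sequence_exact₃ H hS x (n₁ := 2) rfl (Subsingleton.elim _ _)
  rw [Subsingleton.elim y 0, Ext.zero_comp]

end Ext

/-- Pushing out a short exact sequence `K ⟶ G ⟶ M` along a monomorphism `i : G ⟶ C`. -/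
theorem IsSES.exists_pushout {K G M C : A} {f : K ⟶ G} {g : G ⟶ M} (h : IsSES f g)
    (i : G ⟶ C) [Mono i] :
    ∃ (D : A) (π : C ⟶ D) (u : G ⟶ M ⊞ C) (v : M ⊞ C ⟶ D), IsSES (f ≫ i) π ∧ IsSES u v := by
  obtain ⟨hw, hS⟩ := h
  have hf : Mono f := hS.mono_f
  have hg : Epi g := hS.epi_g
  let π := cokernel.π (f ≫ i)
  have hπ : f ≫ i ≫ π = 0 := by
    rw [← Category.assoc, cokernel.condition]
  have hπex : (ShortComplex.mk (f ≫ i) π (cokernel.condition _)).Exact :=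
    ShortComplex.exact_cokernel _
  let m : M ⟶ cokernel (f ≫ i) := hS.exact.desc (i ≫ π) hπ
  have hm : g ≫ m = i ≫ π := hS.exact.g_desc _ _
  have huv : biprod.lift g i ≫ biprod.desc m (-π) = 0 := by simp [hm]
  refine ⟨_, π, biprod.lift g i, biprod.desc m (-π),
    ⟨_, ShortComplex.ShortExact.mk' hπex ?_ ?_⟩,
    ⟨huv, ShortComplex.ShortExact.mk' ?_ ?_ ?_⟩⟩
  · dsimp only
    infer_instance
  · dsimp only [π]
    infer_instance
  · rw [ShortComplex.exact_iff_exact_up_to_refinements]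
    intro T (z : T ⟶ M ⊞ C) (hz : z ≫ biprod.desc m (-π) = 0)
    have hz' : (z ≫ biprod.fst) ≫ m = (z ≫ biprod.snd) ≫ π := by
      rw [biprod.desc_eq] at hz
      simpa [← sub_eq_add_neg, sub_eq_zero] using hz
    obtain ⟨T₁, q₁, hq₁, y, hy⟩ := surjective_up_to_refinements_of_epi g (z ≫ biprod.fst)
    obtain ⟨T₂, q₂, hq₂, k, hk⟩ := hπex.exact_up_to_refinements
      (q₁ ≫ z ≫ biprod.snd - y ≫ i) (by
        dsimp only
        have := hy =≫ m
        simp only [Category.assoc] at this hz'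
        simp [← hz', this, hm])
    refine ⟨T₂, q₂ ≫ q₁, inferInstance, q₂ ≫ y + k ≫ f, ?_⟩
    dsimp only at hk ⊢
    apply biprod.hom_ext
    · simp [hy, hw]
    · simp only [Preadditive.comp_sub, sub_eq_iff_eq_add] at hk
      simp [hk, add_comm]
  · dsimp only
    exact mono_of_mono_fac (biprod.lift_snd g i)
  · dsimp only
    have : Epi (-π) := by
      dsimp only [π]
      infer_instance
    exact epi_of_epi_fac (biprod.inr_desc m (-π))

/-- given a short exact sequence `0 ⟶ K ⟶ G ⟶ M ⟶ 0` with
`K ∈ 𝒢(𝒞)^{⊥1}` and `G ∈ 𝒢(𝒞)`, there is a short exact sequence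
`0 ⟶ G ⟶ M ⊕ C ⟶ K' ⟶ 0` with `C ∈ 𝒞` and `K' ∈ 𝒢(𝒞)^{⊥1}`. -/
theorem stmt_14 [HasExt.{w} A] (𝒞 : A → Prop) (hadd : IsAdditiveClosed 𝒞)
    (hso : SelfOrthogonal 𝒞) (hgen : ProjIsGeneratorFor 𝒞)
    {K G M : A} (f : K ⟶ G) (g : G ⟶ M) (hses : IsSES f g)
    (hK : RightPerp1 𝒞 K) (hG : IsGorenstein 𝒞 G) :
    ∃ (C K' : A) (u : G ⟶ M ⊞ C) (v : M ⊞ C ⟶ K'),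
      𝒞 C ∧ RightPerp1 𝒞 K' ∧ IsSES u v := by
  obtain ⟨C, i, hC, hi⟩ := hG.exists_mono
  obtain ⟨D, π, u, v, hD, huv⟩ := hses.exists_pushout i
  exact ⟨C, D, u, v, hC, hD.rightPerp1 hso hgen hK hC, huv⟩
end

section
/- Let M be an object of 𝒜 admitting a special 𝒢(𝒞)-precover. Then there exists a short exact sequence 0→K→C→M→0 in 𝒜 with C∈𝒞 which remains exact after applying Hom_𝒜(C',−) for every C'∈𝒞. -/
open CategoryTheory CategoryTheory.Limits CategoryTheory.Abelian ZeroObject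

universe w t v u

variable {A : Type u} [Category.{v} A] [Abelian A]

/-- The square-zero endomorphism `(x, y) ↦ (0, x)` of `C ⊞ C`. -/
noncomputable def biprodShift (C : A) : C ⊞ C ⟶ C ⊞ C := biprod.fst ≫ biprod.inr

lemma biprodShift_comp_self (C : A) : biprodShift C ≫ biprodShift C = 0 := by
  simp [biprodShift]

lemma exists_comp_biprodShift {C Y : A} (h : Y ⟶ C ⊞ C) (w : h ≫ biprodShift C = 0) :
    ∃ k : Y ⟶ C ⊞ C, k ≫ biprodShift C = h := by
  have w' : h ≫ biprod.fst = 0 := by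
    have := w =≫ biprod.snd
    simpa [biprodShift] using this
  refine ⟨h ≫ biprod.snd ≫ biprod.inl, ?_⟩
  apply biprod.hom_ext <;> simp [biprodShift, w']

lemma exists_biprodShift_comp {C Y : A} (h : C ⊞ C ⟶ Y) (w : biprodShift C ≫ h = 0) :
    ∃ k : C ⊞ C ⟶ Y, biprodShift C ≫ k = h := by
  have w' : biprod.inr ≫ h = 0 := by
    have := biprod.inl ≫= w
    simpa [biprodShift] using this
  refine ⟨biprod.snd ≫ biprod.inl ≫ h, ?_⟩
  apply biprod.hom_ext' <;> simp [biprodShift, w']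

/-- Every object of `𝒞` is Gorenstein, as the image of the differential of the contractible
complex with constant term `C ⊞ C`. -/
lemma IsAdditiveClosed.isGorenstein {𝒞 : A → Prop} (hadd : IsAdditiveClosed 𝒞) {C : A}
    (hC : 𝒞 C) : IsGorenstein 𝒞 C := by
  refine ⟨fun _ => C ⊞ C, fun _ => biprodShift C, fun _ => biprodShift_comp_self C,
    fun _ => hadd.2.2 hC hC, fun _ => ?_, fun _ Y _ h => ⟨exists_comp_biprodShift h, ?_⟩,
    fun _ Y _ h => ⟨exists_biprodShift_comp h, ?_⟩,
    ⟨image.isoStrongEpiMono (biprod.fst : C ⊞ C ⟶ C) biprod.inr rfl⟩⟩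
  · rw [ShortComplex.exact_iff_exact_up_to_refinements]
    intro Y h w
    obtain ⟨k, hk⟩ := exists_comp_biprodShift h w
    exact ⟨Y, 𝟙 Y, inferInstance, k, by simpa using hk.symm⟩
  · rintro ⟨k, rfl⟩
    simp [biprodShift_comp_self]
  · rintro ⟨k, rfl⟩
    simp [← Category.assoc, biprodShift_comp_self]

/-- A Gorenstein object is a quotient of an object of `𝒞` along a morphism through which every
morphism from an object of `𝒞` factors. -/
lemma IsGorenstein.exists_epi {𝒞 : A → Prop} {G : A} (hG : IsGorenstein 𝒞 G) :
    ∃ (C : A) (p : C ⟶ G), 𝒞 C ∧ Epi p ∧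
      ∀ ⦃C' : A⦄, 𝒞 C' → Function.Surjective (fun h : C' ⟶ C => h ≫ p) := by
  obtain ⟨X, d, hw, hX, -, hleft, -, ⟨e⟩⟩ := hG
  refine ⟨X 0, factorThruImage (d 0) ≫ e.inv, hX 0, inferInstance, fun C' hC' h => ?_⟩
  have hι : Limits.image.ι (d 0) ≫ d (0 + 1) = 0 := by
    rw [← cancel_epi (factorThruImage (d 0)), image.fac_assoc, hw, comp_zero]
  obtain ⟨k, hk⟩ := (hleft 0 hC' (h ≫ e.hom ≫ Limits.image.ι (d 0))).1
    (by simp only [Category.assoc, hι, comp_zero])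
  refine ⟨k, ?_⟩
  rw [← cancel_mono e.hom, ← cancel_mono (Limits.image.ι (d 0))]
  simpa using hk

lemma isSES_kernel_ι {X Y : A} (g : X ⟶ Y) [Epi g] : IsSES (kernel.ι g) g :=
  ⟨kernel.condition g,
    { exact := ShortComplex.exact_kernel g
      mono_f := inferInstanceAs (Mono (kernel.ι g))
      epi_g := inferInstanceAs (Epi g) }⟩

lemma homLeftExact_kernel_ι {𝒞 : A → Prop} {X Y : A} (g : X ⟶ Y)
    (hg : ∀ ⦃C : A⦄, 𝒞 C → Function.Surjective (fun h : C ⟶ X => h ≫ g)) :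
    HomLeftExact 𝒞 (kernel.ι g) g := by
  refine fun C hC => ⟨fun a b hab => (cancel_mono (kernel.ι g)).1 hab,
    fun h => ⟨fun w => ⟨kernel.lift g h w, kernel.lift_ι _ _ _⟩, ?_⟩, hg hC⟩
  rintro ⟨k, rfl⟩
  simp

/-- every `M` admitting a special `𝒢(𝒞)`-precover fits in a
`Hom(𝒞,-)`-exact short exact sequence `0 ⟶ K ⟶ C ⟶ M ⟶ 0` with `C ∈ 𝒞`. -/
theorem stmt_15 [HasExt.{w} A] (𝒞 : A → Prop) (hadd : IsAdditiveClosed 𝒞)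
    (hso : SelfOrthogonal 𝒞) (hgen : ProjIsGeneratorFor 𝒞)
    (M : A) (hM : HasSpecialPrecover 𝒞 M) :
    ∃ (K C : A) (f : K ⟶ C) (g : C ⟶ M),
      𝒞 C ∧ IsSES f g ∧ HomLeftExact 𝒞 f g := by
  obtain ⟨G, q, hG, _, -, hq⟩ := hM
  obtain ⟨C, p, hC, _, hp⟩ := hG.exists_epi
  refine ⟨kernel (p ≫ q), C, kernel.ι _, p ≫ q, hC, isSES_kernel_ι _,
    homLeftExact_kernel_ι _ fun C' hC' h => ?_⟩
  obtain ⟨l, rfl⟩ := hq (hadd.isGorenstein hC') h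
  obtain ⟨k, rfl⟩ := hp hC' l
  exact ⟨k, by simp⟩
end
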